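/- arXiv:0801.3094 — 3 statements merged into one kernel-verified Lean document; each statement's English description precedes it below -/
import Mathlib

section
/- There exists a constant c₁ > 1 with the following property. For each odd integer p ≥ 3 let n(p) be any natural number with n(p) < c₁·log₂ p. Then ‖P_{n(p),p} − U‖ → 1 as p → ∞ along odd integers; that is, for every δ > 0 there exists P₀ such that for every odd p ≥ P₀ one has ‖P_{n(p),p} − U‖ > 1 − δ. -/
open MeasureTheory

/-- `μ` is the infinite product over `ℕ` of the uniform probability measure on
`{-1,0,1} ⊆ ℤ`: it is characterized by its values on cylinder sets, namely the
probability that the first `n` coordinates take prescribed values `c 0, …, c (n-1)`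
is `∏_{i<n} (1/3 if c i ∈ {-1,0,1}, else 0)`.  (Taking `n = 0` shows `μ` is a
probability measure.) -/
def IsCDGProductMeasure (μ : Measure (ℕ → ℤ)) : Prop :=
  ∀ (n : ℕ) (c : ℕ → ℤ),
    μ {ω : ℕ → ℤ | ∀ i < n, ω i = c i} =
      ∏ i ∈ Finset.range n,
        (if c i = -1 ∨ c i = 0 ∨ c i = 1 then (1 / 3 : ENNReal) else 0)

/-- `X n ω = ∑_{i=0}^{n-1} 2^(n-1-i) ω i`, the position after `n` steps of the
Chung–Diaconis–Graham process (before reduction mod `p`). -/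
def cdgX (n : ℕ) (ω : ℕ → ℤ) : ℤ := ∑ i ∈ Finset.range n, 2 ^ (n - 1 - i) * ω i

/-- The total variation distance `‖P_{n,p} − U‖ = (1/2) ∑_{s ∈ ℤ/pℤ} |P_{n,p}(s) − 1/p|`,
where `P_{n,p}(s) = μ {ω | X_n(ω) ≡ s (mod p)}` (the sum over `ℤ/pℤ` is written as a
sum over `s ∈ {0, …, p-1}`, each residue occurring exactly once). -/
noncomputable def cdgTV (μ : Measure (ℕ → ℤ)) (n p : ℕ) : ℝ :=
  (1 / 2) * ∑ s ∈ Finset.range p,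
    |(μ {ω : ℕ → ℤ | ((cdgX n ω : ZMod p)) = (s : ZMod p)}).toReal - 1 / (p : ℝ)|


lemma cdg_isProb {μ : Measure (ℕ → ℤ)} (hμ : IsCDGProductMeasure μ) : IsProbabilityMeasure μ := by
  refine ⟨?_⟩
  have h := hμ 0 0
  simpa using h

/-- Independence (as an inequality) of the next coordinate from the past. -/
lemma cdg_step {μ : Measure (ℕ → ℤ)} (hμ : IsCDGProductMeasure μ) (n : ℕ) (d : ℤ)
    (E : Set (ℕ → ℤ)) (hE : ∀ ω ω' : ℕ → ℤ, (∀ i < n, ω i = ω' i) → ω ∈ E → ω' ∈ E) :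
    μ (E ∩ {ω | ω n = d}) ≤
      μ E * (if d = -1 ∨ d = 0 ∨ d = 1 then (1 / 3 : ENNReal) else 0) := by
  classical
  let ext : (Fin n → ℤ) → ℕ → ℤ := fun c i => if h : i < n then c ⟨i, h⟩ else d
  have hext : ∀ c i (h : i < n), ext c i = c ⟨i, h⟩ := fun c i h => by simp [ext, h]
  have hextn : ∀ c, ext c n = d := fun c => by simp [ext]
  let I := {c : Fin n → ℤ // ext c ∈ E}
  let cyl : I → Set (ℕ → ℤ) := fun c => {ω | ∀ i < n, ω i = ext c.1 i}
  have hEeq : E = ⋃ c : I, cyl c := by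
    ext ω
    simp only [Set.mem_iUnion]
    constructor
    · intro h
      have h1 : ∀ i < n, ω i = ext (fun j => ω j) i := fun i hi => (hext (fun j => ω j) i hi).symm
      exact ⟨⟨fun j => ω j, hE ω _ h1 h⟩, h1⟩
    · rintro ⟨c, hc⟩
      exact hE _ _ (fun i hi => (hc i hi).symm) c.2
  have hdisj : Pairwise (Function.onFun Disjoint cyl) := by
    intro c c' hcc
    rw [Function.onFun, Set.disjoint_left]
    intro ω h h'
    apply hcc
    apply Subtype.ext
    funext j
    have a := h j j.2
    have b := h' j j.2
    rw [hext _ _ j.2] at a b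
    exact a.symm.trans b
  have hmeas : ∀ c, MeasurableSet (cyl c) := by
    intro c
    have : cyl c = ⋂ i : ℕ, ⋂ _ : i < n, (fun ω : ℕ → ℤ => ω i) ⁻¹' {ext c.1 i} := by
      ext ω; simp [cyl]
    rw [this]
    refine MeasurableSet.iInter fun i => MeasurableSet.iInter fun _ => ?_
    exact (measurable_pi_apply i) (measurableSet_singleton _)
  have hsub : E ∩ {ω | ω n = d} ⊆ ⋃ c : I, {ω | ∀ i < n + 1, ω i = ext c.1 i} := by
    rintro ω ⟨h1, h2⟩
    rw [hEeq] at h1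
    obtain ⟨c, hc⟩ := Set.mem_iUnion.1 h1
    refine Set.mem_iUnion.2 ⟨c, fun i hi => ?_⟩
    rcases Nat.lt_succ_iff_lt_or_eq.1 hi with h | h
    · exact hc i h
    · subst h; rw [hextn]; exact h2
  calc μ (E ∩ {ω | ω n = d}) ≤ μ (⋃ c : I, {ω | ∀ i < n + 1, ω i = ext c.1 i}) := measure_mono hsub
    _ ≤ ∑' c : I, μ {ω | ∀ i < n + 1, ω i = ext c.1 i} := measure_iUnion_le _
    _ = ∑' c : I, μ (cyl c) * (if d = -1 ∨ d = 0 ∨ d = 1 then (1 / 3 : ENNReal) else 0) := by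
        congr 1
        funext c
        rw [hμ (n + 1) (ext c.1), Finset.prod_range_succ, hextn, ← hμ n (ext c.1)]
    _ = (∑' c : I, μ (cyl c)) * (if d = -1 ∨ d = 0 ∨ d = 1 then (1 / 3 : ENNReal) else 0) :=
        ENNReal.tsum_mul_right
    _ = _ := by rw [← measure_iUnion hdisj hmeas, ← hEeq]

lemma cdg_step_real {μ : Measure (ℕ → ℤ)} (hμ : IsCDGProductMeasure μ) (n : ℕ) (d : ℤ)
    (hd : d = -1 ∨ d = 0 ∨ d = 1)
    (E : Set (ℕ → ℤ)) (hE : ∀ ω ω' : ℕ → ℤ, (∀ i < n, ω i = ω' i) → ω ∈ E → ω' ∈ E) :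
    μ.real (E ∩ {ω | ω n = d}) ≤ μ.real E / 3 := by
  have := cdg_isProb hμ
  have h := cdg_step hμ n d E hE
  rw [if_pos hd] at h
  have h2 := ENNReal.toReal_mono (by finiteness) h
  rw [ENNReal.toReal_mul] at h2
  simp only [Measure.real]
  refine h2.trans (le_of_eq ?_)
  simp [div_eq_mul_inv]

lemma cdg_null {μ : Measure (ℕ → ℤ)} (hμ : IsCDGProductMeasure μ) (n : ℕ) :
    μ.real {ω | ¬ (ω n = -1 ∨ ω n = 0 ∨ ω n = 1)} = 0 := by
  have : {ω : ℕ → ℤ | ¬ (ω n = -1 ∨ ω n = 0 ∨ ω n = 1)} ⊆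
      ⋃ d : {d : ℤ // ¬ (d = -1 ∨ d = 0 ∨ d = 1)}, Set.univ ∩ {ω | ω n = d.1} := by
    intro ω h
    exact Set.mem_iUnion.2 ⟨⟨ω n, h⟩, trivial, rfl⟩
  have h0 : μ {ω | ¬ (ω n = -1 ∨ ω n = 0 ∨ ω n = 1)} = 0 := by
    refine measure_mono_null this (measure_iUnion_null fun d => ?_)
    have h := cdg_step hμ n d.1 Set.univ (fun _ _ _ _ => trivial)
    rw [if_neg d.2, mul_zero] at h
    exact le_antisymm h bot_le
  rw [Measure.real, h0, ENNReal.toReal_zero]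

lemma cdgX_succ (n : ℕ) (ω : ℕ → ℤ) : cdgX (n + 1) ω = 2 * cdgX n ω + ω n := by
  unfold cdgX
  rw [Finset.sum_range_succ, Finset.mul_sum]
  congr 1
  · refine Finset.sum_congr rfl fun i hi => ?_
    have hi := Finset.mem_range.1 hi
    have : n + 1 - 1 - i = (n - 1 - i) + 1 := by omega
    rw [this, pow_succ]; ring
  · simp

lemma cdgX_congr (n : ℕ) (ω ω' : ℕ → ℤ) (h : ∀ i < n, ω i = ω' i) : cdgX n ω = cdgX n ω' := by
  unfold cdgX
  refine Finset.sum_congr rfl fun i hi => ?_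
  rw [h i (Finset.mem_range.1 hi)]

/-- The law of the unreduced process. -/
noncomputable def cdgF (μ : Measure (ℕ → ℤ)) (n : ℕ) (x : ℤ) : ℝ := μ.real {ω | cdgX n ω = x}

lemma cdgF_nonneg (μ : Measure (ℕ → ℤ)) (n : ℕ) (x : ℤ) : 0 ≤ cdgF μ n x := measureReal_nonneg

lemma cdgF_even {μ : Measure (ℕ → ℤ)} (hμ : IsCDGProductMeasure μ) (n : ℕ) (x : ℤ) :
    cdgF μ (n + 1) (2 * x) ≤ cdgF μ n x / 3 := by
  have := cdg_isProb hμ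
  have hs : {ω : ℕ → ℤ | cdgX (n + 1) ω = 2 * x} ⊆
      ({ω | cdgX n ω = x} ∩ {ω | ω n = 0}) ∪ {ω | ¬ (ω n = -1 ∨ ω n = 0 ∨ ω n = 1)} := by
    intro ω h
    simp only [Set.mem_ofPred_eq, cdgX_succ, Set.mem_union, Set.mem_inter_iff] at h ⊢
    omega
  have h1 := cdg_step_real hμ n 0 (by simp) {ω | cdgX n ω = x}
    (fun ω ω' h h' => by
      simp only [Set.mem_ofPred_eq] at h' ⊢
      rw [← h']; exact (cdgX_congr n ω ω' h).symm)
  have h2 := (measureReal_mono hs (by finiteness)).trans (measureReal_union_le (μ := μ) _ _)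
  rw [cdg_null hμ] at h2
  unfold cdgF
  linarith

lemma cdgF_odd {μ : Measure (ℕ → ℤ)} (hμ : IsCDGProductMeasure μ) (n : ℕ) (x : ℤ) :
    cdgF μ (n + 1) (2 * x + 1) ≤ (cdgF μ n x + cdgF μ n (x + 1)) / 3 := by
  have := cdg_isProb hμ
  have hs : {ω : ℕ → ℤ | cdgX (n + 1) ω = 2 * x + 1} ⊆
      (({ω | cdgX n ω = x} ∩ {ω | ω n = 1}) ∪ ({ω | cdgX n ω = x + 1} ∩ {ω | ω n = -1})) ∪
        {ω | ¬ (ω n = -1 ∨ ω n = 0 ∨ ω n = 1)} := by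
    intro ω h
    simp only [Set.mem_ofPred_eq, cdgX_succ, Set.mem_union, Set.mem_inter_iff] at h ⊢
    omega
  have h1 := fun d hd y => cdg_step_real hμ n d hd {ω | cdgX n ω = y}
    (fun ω ω' h h' => by
      simp only [Set.mem_ofPred_eq] at h' ⊢
      rw [← h']; exact (cdgX_congr n ω ω' h).symm)
  have ha := h1 1 (by simp) x
  have hb := h1 (-1) (by simp) (x + 1)
  have h2 := (measureReal_mono hs (by finiteness)).trans (measureReal_union_le (μ := μ) _ _)
  have h3 := measureReal_union_le (μ := μ) ({ω : ℕ → ℤ | cdgX n ω = x} ∩ {ω | ω n = 1})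
    ({ω | cdgX n ω = x + 1} ∩ {ω | ω n = -1})
  rw [cdg_null hμ] at h2
  unfold cdgF
  linarith

lemma cdgF_supp {μ : Measure (ℕ → ℤ)} (hμ : IsCDGProductMeasure μ) (n : ℕ) :
    ∀ x : ℤ, (2 ^ n ≤ x ∨ x ≤ - 2 ^ n) → cdgF μ n x = 0 := by
  induction n with
  | zero =>
    intro x hx
    have : {ω : ℕ → ℤ | cdgX 0 ω = x} = ∅ := by
      ext ω
      simp only [cdgX, Finset.range_zero, Finset.sum_empty, Set.mem_ofPred_eq,
        Set.mem_empty_iff_false, iff_false]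
      simp only [pow_zero] at hx
      omega
    simp [cdgF, this]
  | succ n ih =>
    intro x hx
    rw [pow_succ] at hx
    refine le_antisymm ?_ (cdgF_nonneg _ _ _)
    rcases Int.even_or_odd' x with ⟨y, rfl | rfl⟩
    · have := cdgF_even hμ n y
      rw [ih y (by omega)] at this
      simpa using this
    · have := cdgF_odd hμ n y
      rw [ih y (by omega), ih (y + 1) (by omega)] at this
      simpa using this

lemma sum_Ico_double (g : ℤ → ℝ) (N : ℤ) :
    ∑ x ∈ Finset.Ico (-(N * 2)) (N * 2), g x =
      ∑ x ∈ Finset.Ico (-N) N, (g (2 * x) + g (2 * x + 1)) := by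
  classical
  rw [Finset.sum_add_distrib]
  rw [← Finset.sum_filter_add_sum_filter_not (Finset.Ico (-(N * 2)) (N * 2)) (fun x => x % 2 = 0)]
  congr 1
  · symm
    refine Finset.sum_bij' (fun x _ => 2 * x) (fun x _ => x / 2) ?_ ?_ ?_ ?_ ?_ <;>
      simp only [Finset.mem_filter, Finset.mem_Ico] <;> first | (intros; rfl) | (intros; omega) | grind
  · symm
    refine Finset.sum_bij' (fun x _ => 2 * x + 1) (fun x _ => x / 2) ?_ ?_ ?_ ?_ ?_ <;>
      simp only [Finset.mem_filter, Finset.mem_Ico] <;> first | (intros; rfl) | (intros; omega) | grind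

noncomputable def cdgB (μ : Measure (ℕ → ℤ)) (n : ℕ) : ℝ :=
  ∑ x ∈ Finset.Ico (-(2 ^ n : ℤ)) (2 ^ n), √(cdgF μ n x + cdgF μ n (x + 1))

lemma sqrt_pair {u v w : ℝ} (hu : 0 ≤ u) (hv : 0 ≤ v) (hw : 2 * (u + v) ≤ w) :
    √u + √v ≤ √w := by
  apply Real.le_sqrt_of_sq_le
  have h1 := Real.sq_sqrt hu
  have h2 := Real.sq_sqrt hv
  nlinarith [sq_nonneg (√u - √v)]

lemma sqrt_four {a b : ℝ} (ha : 0 ≤ a) (hb : 0 ≤ b) :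
    √((3 * a + b) / 9) + √((3 * a + 2 * b) / 9) + √((2 * a + 3 * b) / 9) + √((a + 3 * b) / 9)
      ≤ 1.997 * √(a + b) := by
  have h1 : √((3 * a + b) / 9) + √((a + 3 * b) / 9) ≤ √(0.9429 ^ 2 * (a + b)) :=
    sqrt_pair (by positivity) (by positivity) (by linarith)
  have h2 : √((3 * a + 2 * b) / 9) + √((2 * a + 3 * b) / 9) ≤ √(1.0541 ^ 2 * (a + b)) :=
    sqrt_pair (by positivity) (by positivity) (by linarith)
  rw [Real.sqrt_mul (by positivity), Real.sqrt_sq (by norm_num)] at h1 h2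
  have := Real.sqrt_nonneg (a + b)
  linarith

lemma cdgB_step {μ : Measure (ℕ → ℤ)} (hμ : IsCDGProductMeasure μ) (n : ℕ) :
    cdgB μ (n + 2) ≤ 1.997 * cdgB μ n := by
  unfold cdgB
  rw [pow_succ, sum_Ico_double, pow_succ, sum_Ico_double, Finset.mul_sum]
  refine Finset.sum_le_sum fun x _ => ?_
  refine le_trans ?_ (sqrt_four (cdgF_nonneg μ n x) (cdgF_nonneg μ n (x + 1)))
  have e0 := cdgF_even hμ n x
  have e1 := cdgF_odd hμ n x
  have e2 := cdgF_even hμ n (x + 1)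
  have g0 := cdgF_even hμ (n + 1) (2 * x)
  have g1 := cdgF_odd hμ (n + 1) (2 * x)
  have g2 := cdgF_even hμ (n + 1) (2 * x + 1)
  have g3 := cdgF_odd hμ (n + 1) (2 * x + 1)
  have g4 := cdgF_even hμ (n + 1) (2 * (x + 1))
  have i1 : 2 * x + 1 + 1 = 2 * (x + 1) := by ring
  have i2 : 2 * (2 * x) + 1 + 1 = 2 * (2 * x + 1) := by ring
  have i3 : 2 * (2 * x + 1) + 1 + 1 = 2 * (2 * (x + 1)) := by ring
  rw [i1] at g3
  rw [i2, i3, ← add_assoc]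
  gcongr <;> linarith

lemma cdgB_bound {μ : Measure (ℕ → ℤ)} (hμ : IsCDGProductMeasure μ) (n : ℕ) :
    cdgB μ n ≤ (cdgB μ 0 + cdgB μ 1) * √1.997 ^ n := by
  have hB : ∀ n, 0 ≤ cdgB μ n := fun n => Finset.sum_nonneg fun _ _ => Real.sqrt_nonneg _
  have hs : √1.997 ^ 2 = 1.997 := Real.sq_sqrt (by norm_num)
  have h1 : (1 : ℝ) ≤ √1.997 := Real.one_le_sqrt.2 (by norm_num)
  induction n using Nat.twoStepInduction with
  | zero => simp [hB 1]
  | one => rw [pow_one]; nlinarith [hB 0, hB 1]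
  | more n ih _ =>
    rw [pow_add, hs]
    have := cdgB_step hμ n
    linarith

lemma sqrt_sum_le' {ι : Type*} (s : Finset ι) (f : ι → ℝ) (hf : ∀ i, 0 ≤ f i) :
    √(∑ i ∈ s, f i) ≤ ∑ i ∈ s, √(f i) := by
  classical
  induction s using Finset.induction_on with
  | empty => simp
  | insert a s ha ih =>
    rw [Finset.sum_insert ha, Finset.sum_insert ha]
    have h := Finset.sum_nonneg (s := s) fun i _ => hf i
    have : √(f a + ∑ i ∈ s, f i) ≤ √(f a) + √(∑ i ∈ s, f i) := by
      apply Real.sqrt_le_iff.2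
      constructor
      · positivity
      · nlinarith [Real.sq_sqrt h, Real.sq_sqrt (hf a), Real.sqrt_nonneg (f a),
          Real.sqrt_nonneg (∑ i ∈ s, f i), mul_nonneg (Real.sqrt_nonneg (f a))
          (Real.sqrt_nonneg (∑ i ∈ s, f i))]
    linarith

lemma zmod_iff (p : ℕ) (hp : 0 < p) (x : ℤ) (s : ℕ) (hs : s < p) :
    ((x : ZMod p) = (s : ZMod p)) ↔ (x % p).toNat = s := by
  have : ((x : ZMod p) = (s : ZMod p)) ↔ ((x : ZMod p) = ((s : ℤ) : ZMod p)) := by simp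
  rw [this, ZMod.intCast_eq_intCast_iff', Int.emod_eq_of_lt (a := (s : ℤ)) (by omega) (by omega)]
  have := Int.emod_nonneg x (b := (p : ℤ)) (by omega)
  omega

lemma cdgP_le {μ : Measure (ℕ → ℤ)} (hμ : IsCDGProductMeasure μ) (n p : ℕ) (hp : 0 < p)
    (s : ℕ) (hs : s < p) :
    μ.real {ω : ℕ → ℤ | ((cdgX n ω : ZMod p)) = (s : ZMod p)} ≤
      ∑ x ∈ (Finset.Ico (-(2 ^ n : ℤ)) (2 ^ n)).filter (fun x => (x % (p : ℤ)).toNat = s),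
        cdgF μ n x := by
  have := cdg_isProb hμ
  have hsub : {ω : ℕ → ℤ | ((cdgX n ω : ZMod p)) = (s : ZMod p)} ⊆
      (⋃ x ∈ (Finset.Ico (-(2 ^ n : ℤ)) (2 ^ n)).filter (fun x => (x % (p : ℤ)).toNat = s),
        {ω | cdgX n ω = x}) ∪
      ⋃ x : {x : ℤ // ¬ (-(2 ^ n : ℤ) ≤ x ∧ x < 2 ^ n)}, {ω | cdgX n ω = x.1} := by
    intro ω h
    rw [Set.mem_ofPred_eq, zmod_iff p hp _ s hs] at h
    by_cases hx : -(2 ^ n : ℤ) ≤ cdgX n ω ∧ cdgX n ω < 2 ^ n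
    · left
      simp only [Set.mem_iUnion]
      exact ⟨cdgX n ω, by simp [hx, h], rfl⟩
    · right
      exact Set.mem_iUnion.2 ⟨⟨_, hx⟩, rfl⟩
  have h2 := (measureReal_mono hsub (by finiteness)).trans (measureReal_union_le (μ := μ) _ _)
  have h0 : μ (⋃ x : {x : ℤ // ¬ (-(2 ^ n : ℤ) ≤ x ∧ x < 2 ^ n)}, {ω | cdgX n ω = x.1}) = 0 := by
    refine measure_iUnion_null fun x => ?_
    have := cdgF_supp hμ n x.1 (by have := x.2; omega)
    unfold cdgF at this
    exact (measureReal_eq_zero_iff (by finiteness)).1 this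
  have h0' : μ.real (⋃ x : {x : ℤ // ¬ (-(2 ^ n : ℤ) ≤ x ∧ x < 2 ^ n)}, {ω | cdgX n ω = x.1}) = 0 := by
    simp [Measure.real, h0]
  rw [h0', add_zero] at h2
  exact h2.trans (measureReal_biUnion_finset_le _ _)

lemma cdg_sqrt_sum {μ : Measure (ℕ → ℤ)} (hμ : IsCDGProductMeasure μ) (n p : ℕ) (hp : 0 < p) :
    ∑ s ∈ Finset.range p, √(μ.real {ω : ℕ → ℤ | ((cdgX n ω : ZMod p)) = (s : ZMod p)}) ≤
      cdgB μ n := by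
  calc _ ≤ ∑ s ∈ Finset.range p,
        ∑ x ∈ (Finset.Ico (-(2 ^ n : ℤ)) (2 ^ n)).filter (fun x => (x % (p : ℤ)).toNat = s),
        √(cdgF μ n x) := by
        refine Finset.sum_le_sum fun s hs => ?_
        exact (Real.sqrt_le_sqrt (cdgP_le hμ n p hp s (Finset.mem_range.1 hs))).trans
          (sqrt_sum_le' _ _ (cdgF_nonneg μ n))
    _ = ∑ x ∈ Finset.Ico (-(2 ^ n : ℤ)) (2 ^ n), √(cdgF μ n x) := by
        refine Finset.sum_fiberwise_of_maps_to ?_ _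
        intro x _
        have := Int.emod_lt_of_pos x (b := (p : ℤ)) (by omega)
        rw [Finset.mem_range]
        omega
    _ ≤ _ := by
        refine Finset.sum_le_sum fun x _ => Real.sqrt_le_sqrt ?_
        linarith [cdgF_nonneg μ n (x + 1)]

lemma abs_ge {a b : ℝ} (ha : 0 ≤ a) (hb : 0 ≤ b) : a + b - 2 * (√a * √b) ≤ |a - b| := by
  have h1 := Real.sq_sqrt ha
  have h2 := Real.sq_sqrt hb
  have h3 := Real.sqrt_nonneg a
  have h4 := Real.sqrt_nonneg b
  rcases le_total (√a) (√b) with h | h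
  · refine le_trans ?_ (neg_le_abs _); nlinarith
  · refine le_trans ?_ (le_abs_self _); nlinarith

lemma cdgTV_ge {μ : Measure (ℕ → ℤ)} (hμ : IsCDGProductMeasure μ) (n p : ℕ) (hp : 0 < p) :
    1 - cdgB μ n * √(1 / (p : ℝ)) ≤ cdgTV μ n p := by
  have := cdg_isProb hμ
  set P : ℕ → ℝ := fun s => μ.real {ω : ℕ → ℤ | ((cdgX n ω : ZMod p)) = (s : ZMod p)} with hP
  have hP1 : 1 ≤ ∑ s ∈ Finset.range p, P s := by
    have hsub : (Set.univ : Set (ℕ → ℤ)) ⊆ ⋃ s ∈ Finset.range p,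
        {ω : ℕ → ℤ | ((cdgX n ω : ZMod p)) = (s : ZMod p)} := by
      intro ω _
      have := Int.emod_lt_of_pos (cdgX n ω) (b := (p : ℤ)) (by omega)
      have hlt : (cdgX n ω % (p : ℤ)).toNat < p := by omega
      simp only [Set.mem_iUnion]
      exact ⟨_, Finset.mem_range.2 hlt, (zmod_iff p hp _ _ hlt).2 rfl⟩
    have h := (measureReal_mono (μ := μ) hsub (measure_ne_top μ _)).trans
      (measureReal_biUnion_finset_le _ _)
    simpa using h
  have hsum : ∑ s ∈ Finset.range p, (P s + 1 / (p : ℝ) - 2 * (√(P s) * √(1 / (p : ℝ)))) ≤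
      ∑ s ∈ Finset.range p, |P s - 1 / (p : ℝ)| :=
    Finset.sum_le_sum fun s _ => abs_ge measureReal_nonneg (by positivity)
  rw [Finset.sum_sub_distrib, Finset.sum_add_distrib, ← Finset.mul_sum, ← Finset.sum_mul] at hsum
  have hc : ∑ s ∈ Finset.range p, 1 / (p : ℝ) = 1 := by
    have : (p : ℝ) ≠ 0 := by positivity
    simp [this]
  have hB := mul_le_mul_of_nonneg_right (cdg_sqrt_sum hμ n p hp) (Real.sqrt_nonneg (1 / (p : ℝ)))
  have hT : cdgTV μ n p = (1 / 2) * ∑ s ∈ Finset.range p, |P s - 1 / (p : ℝ)| := rfl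
  rw [hT]
  rw [hc] at hsum
  linarith

/-- there is a constant `c₁ > 1` such that whenever `n : ℕ → ℕ` satisfies
`n p < c₁ · log₂ p` for all odd `p ≥ 3`, the total variation distance
`‖P_{n(p),p} − U‖ → 1` as `p → ∞` along odd integers: for every `δ > 0` there is `P₀`
such that `‖P_{n(p),p} − U‖ > 1 − δ` for every odd `p ≥ max(P₀, 3)`. -/
theorem stmt_0 (μ : Measure (ℕ → ℤ)) (hμ : IsCDGProductMeasure μ) :
    ∃ c₁ : ℝ, 1 < c₁ ∧
      ∀ n : ℕ → ℕ, (∀ p : ℕ, 3 ≤ p → Odd p → (n p : ℝ) < c₁ * Real.logb 2 p) →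
        ∀ δ : ℝ, 0 < δ → ∃ P₀ : ℕ, ∀ p : ℕ, P₀ ≤ p → 3 ≤ p → Odd p →
          1 - δ < cdgTV μ (n p) p := by
  set β : ℝ := Real.logb 2 √1.997 with hβ
  have hr1 : (1 : ℝ) < √1.997 := by
    rw [Real.lt_sqrt (by norm_num)]; norm_num
  have hr0 : (0 : ℝ) < √1.997 := by linarith
  have hβ0 : 0 < β := Real.logb_pos (by norm_num) hr1
  have hβ1 : β < 1 / 2 := by
    have h : Real.logb 2 √1.997 < Real.logb 2 √2 :=
      Real.logb_lt_logb (by norm_num) hr0 (Real.sqrt_lt_sqrt (by norm_num) (by norm_num))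
    rwa [Real.sqrt_eq_rpow 2, Real.logb_rpow (by norm_num) (by norm_num)] at h
  have hrβ : (2 : ℝ) ^ β = √1.997 := Real.rpow_logb (by norm_num) (by norm_num) hr0
  refine ⟨(1 + 1 / (2 * β)) / 2, ?_, ?_⟩
  · have : 1 < 1 / (2 * β) := by rw [lt_div_iff₀ (by positivity)]; linarith
    linarith
  intro n hn δ hδ
  set c : ℝ := (1 + 1 / (2 * β)) / 2 with hc
  have hcβ : β * c = (β + 1 / 2) / 2 := by rw [hc]; field_simp
  set γ : ℝ := 1 / 2 - β * c with hγ
  have hγ0 : 0 < γ := by rw [hγ, hcβ]; linarith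
  set C : ℝ := cdgB μ 0 + cdgB μ 1 with hC
  have hC0 : 0 ≤ C := add_nonneg (Finset.sum_nonneg fun _ _ => Real.sqrt_nonneg _)
    (Finset.sum_nonneg fun _ _ => Real.sqrt_nonneg _)
  have hlim : Filter.Tendsto (fun p : ℕ => C * (p : ℝ) ^ (-γ)) Filter.atTop (nhds (C * 0)) :=
    ((tendsto_rpow_neg_atTop hγ0).comp tendsto_natCast_atTop_atTop).const_mul C
  rw [mul_zero] at hlim
  obtain ⟨P₀, hP₀⟩ := Filter.eventually_atTop.1 (hlim.eventually (gt_mem_nhds hδ))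
  refine ⟨P₀, fun p hp hp3 hodd => ?_⟩
  have h1 := hP₀ p hp
  have hpp : (0 : ℝ) < p := by exact_mod_cast (by omega : 0 < p)
  have h2 : √1.997 ^ n p ≤ (p : ℝ) ^ (β * c) := by
    calc √1.997 ^ n p = √1.997 ^ (n p : ℝ) := (Real.rpow_natCast _ _).symm
      _ ≤ √1.997 ^ (c * Real.logb 2 p) :=
        Real.rpow_le_rpow_of_exponent_le hr1.le (hn p hp3 hodd).le
      _ = ((2 : ℝ) ^ (Real.logb 2 p)) ^ (β * c) := by
        rw [← hrβ, ← Real.rpow_mul (by norm_num), ← Real.rpow_mul (by norm_num)]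
        congr 1; ring
      _ = _ := by rw [Real.rpow_logb (by norm_num) (by norm_num) hpp]
  have h3 : √(1 / (p : ℝ)) = (p : ℝ) ^ (-(1 / 2) : ℝ) := by
    rw [Real.sqrt_eq_rpow, one_div, Real.inv_rpow hpp.le, Real.rpow_neg hpp.le]
  have h4 : cdgB μ (n p) * √(1 / (p : ℝ)) ≤ C * (p : ℝ) ^ (-γ) := by
    calc cdgB μ (n p) * √(1 / (p : ℝ)) ≤ (C * (p : ℝ) ^ (β * c)) * √(1 / (p : ℝ)) := by
          gcongr
          exact (cdgB_bound hμ (n p)).trans (mul_le_mul_of_nonneg_left h2 hC0)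
      _ = C * (p : ℝ) ^ (-γ) := by
          rw [h3, mul_assoc, ← Real.rpow_add hpp]
          congr 2
          rw [hγ]; ring
  have h5 := cdgTV_ge hμ (n p) p (by omega)
  linarith
end

section
/- For ω ∈ F_n let n₁(ω) be the number of a ∈ {1, …, n−1} such that b̃_{a-1} = 1, b̃_a = 1, b_{a-1} = 1, and b_a = 1. Then for every ε > 0, the conditional probability μ( (1/18 − ε)·n < n₁ < (1/18 + ε)·n ∣ F_n ) tends to 1 as n → ∞. -/
open MeasureTheory ProbabilityTheory Filter

/-- `S n b = ∑_{i=0}^{n-1} 2^(n-1-i) b i`. -/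
def cdgS (n : ℕ) (b : ℕ → ℤ) : ℤ := ∑ i ∈ Finset.range n, 2 ^ (n - 1 - i) * b i

/-- The standard form `b̃ a` of the sequence `b` for length `n`: the binary digit of
`S = ∑_{i<n} 2^(n-1-i) b i` in position `n-1-a`, so that (in the "first 1" case, where
`1 ≤ S ≤ 2^n − 1`) one has `S = ∑_{a<n} 2^(n-1-a) b̃ a` with each `b̃ a ∈ {0,1}`. -/
def btilde (n : ℕ) (b : ℕ → ℤ) (a : ℕ) : ℕ := (cdgS n b).toNat / 2 ^ (n - 1 - a) % 2

/-- The "first 1" event `F_n` for length `n`: there is `j < n` with `b j = 1` and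
`b k = 0` for all `k < j`. -/
def firstOne (n : ℕ) : Set (ℕ → ℤ) :=
  {b : ℕ → ℤ | ∃ j < n, b j = 1 ∧ ∀ k < j, b k = 0}


namespace CDG

lemma S_succ (n : ℕ) (b : ℕ → ℤ) :
    cdgS (n+1) b = 2 ^ n * b 0 + cdgS n (fun i => b (i+1)) := by
  unfold cdgS
  rw [Finset.sum_range_succ', add_comm]
  congr 1
  refine Finset.sum_congr rfl fun i hi => ?_
  congr 2
  omega

lemma S_split (a k : ℕ) (b : ℕ → ℤ) :
    cdgS (a+k) b = 2 ^ k * cdgS a b + cdgS k (fun i => b (i+a)) := by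
  unfold cdgS
  rw [Finset.sum_range_add, Finset.mul_sum]
  congr 1
  · refine Finset.sum_congr rfl fun i hi => ?_
    have := Finset.mem_range.1 hi
    rw [← mul_assoc, ← pow_add]
    congr 2
    omega
  · refine Finset.sum_congr rfl fun i hi => ?_
    have := Finset.mem_range.1 hi
    rw [add_comm a i]
    congr 2
    omega

/-- The first `n` entries lie in `{-1,0,1}`. -/
def V (n : ℕ) (b : ℕ → ℤ) : Prop := ∀ i < n, b i = -1 ∨ b i = 0 ∨ b i = 1

lemma V.tail {n : ℕ} {b : ℕ → ℤ} (h : V (n+1) b) : V n (fun i => b (i+1)) :=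
  fun i hi => h (i+1) (by omega)

lemma V.shift {n : ℕ} {b : ℕ → ℤ} (h : V n b) (a k : ℕ) (hak : a + k ≤ n) :
    V k (fun i => b (i+a)) :=
  fun i hi => h (i+a) (by omega)

lemma S_bound (n : ℕ) : ∀ b : ℕ → ℤ, V n b → -2 ^ n < cdgS n b ∧ cdgS n b < 2 ^ n := by
  induction n with
  | zero => intro b _; simp [cdgS]
  | succ n ih =>
    intro b hb
    rw [S_succ, pow_succ]
    have := ih _ hb.tail
    rcases hb 0 (by omega) with h | h | h <;> rw [h] <;> constructor <;> linarith

lemma S_nonneg (n : ℕ) : ∀ b : ℕ → ℤ, V n b → b ∈ firstOne n → 0 ≤ cdgS n b := by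
  induction n with
  | zero => intro b _ h; simp [cdgS]
  | succ n ih =>
    intro b hb h
    obtain ⟨j, hj, h1, h0⟩ := h
    rw [S_succ]
    have hB := S_bound n _ hb.tail
    rcases j with _ | j
    · rw [h1]; linarith
    · rw [h0 0 (by omega)]
      have := ih _ hb.tail ⟨j, by omega, h1, fun k hk => h0 (k+1) (by omega)⟩
      linarith

/-- indicator of a nonnegative value -/
noncomputable def u : ℕ → (ℕ → ℤ) → ℝ
  | 0, _ => 1
  | n+1, b => if b 0 = 1 then 1 else if b 0 = 0 then u n (fun i => b (i+1)) else 0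

noncomputable def e : ℕ → (ℕ → ℤ) → ℝ
  | 0, _ => 0
  | n+1, b => if b 0 = 1 then u n (fun i => b (i+1)) else 0

lemma e_succ (n : ℕ) (b : ℕ → ℤ) :
    e (n+1) b = if b 0 = 1 then u n (fun i => b (i+1)) else 0 := rfl

noncomputable def N : ℕ → (ℕ → ℤ) → ℝ
  | 0, _ => 0
  | n+1, b => (if b 0 = 1 then e n (fun i => b (i+1)) else 0) + N n (fun i => b (i+1))

noncomputable def Phi (n : ℕ) (b : ℕ → ℤ) : ℝ := N n b + u n b / 6 + e n b / 3 - n / 18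

lemma u_mem (n : ℕ) : ∀ b, 0 ≤ u n b ∧ u n b ≤ 1 := by
  induction n with
  | zero => intro b; simp [u]
  | succ n ih => intro b; have := ih (fun i => b (i+1)); unfold u; split_ifs <;> simp [this]

lemma e_mem (n : ℕ) (b) : 0 ≤ e n b ∧ e n b ≤ 1 := by
  cases n with
  | zero => simp [e]
  | succ n => have := u_mem n (fun i => b (i+1)); rw [e_succ]; split_ifs <;> simp [this]

lemma u_congr (n : ℕ) : ∀ b c : ℕ → ℤ, (∀ i < n, b i = c i) → u n b = u n c := by
  induction n with
  | zero => intro b c _; rfl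
  | succ n ih =>
    intro b c h
    unfold u
    rw [h 0 (by omega), ih _ (fun i => c (i+1)) fun i hi => h (i+1) (by omega)]

lemma e_congr (n : ℕ) (b c : ℕ → ℤ) (h : ∀ i < n, b i = c i) : e n b = e n c := by
  cases n with
  | zero => rfl
  | succ n =>
    rw [e_succ, e_succ, h 0 (by omega), u_congr n _ (fun i => c (i+1)) fun i hi => h (i+1) (by omega)]

lemma N_congr (n : ℕ) : ∀ b c : ℕ → ℤ, (∀ i < n, b i = c i) → N n b = N n c := by
  induction n with
  | zero => intro b c _; rfl
  | succ n ih =>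
    intro b c h
    have h' : ∀ i < n, b (i+1) = c (i+1) := fun i hi => h (i+1) (by omega)
    unfold N
    rw [h 0 (by omega), ih _ (fun i => c (i+1)) h', e_congr n _ (fun i => c (i+1)) h']

lemma Phi_congr (n : ℕ) (b c : ℕ → ℤ) (h : ∀ i < n, b i = c i) : Phi n b = Phi n c := by
  unfold Phi
  rw [u_congr n b c h, e_congr n b c h, N_congr n b c h]

lemma u_eq (n : ℕ) : ∀ b, V n b → u n b = if 0 ≤ cdgS n b then 1 else 0 := by
  induction n with
  | zero => intro b _; simp [u, cdgS]
  | succ n ih =>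
    intro b hb
    have hB := S_bound n _ hb.tail
    rw [S_succ]
    unfold u
    rcases hb 0 (by omega) with h | h | h
    · rw [h, if_neg (by norm_num), if_neg (by norm_num), if_neg (by linarith)]
    · rw [h, if_neg (by norm_num), if_pos rfl, ih _ hb.tail]; simp
    · rw [h, if_pos rfl, if_pos (by linarith)]

lemma N_eq (n : ℕ) : ∀ b, V n b → N n b = ∑ i ∈ Finset.range (n-1),
    if b i = 1 ∧ b (i+1) = 1 ∧ 0 ≤ cdgS (n-2-i) (fun j => b (j+(i+2))) then (1:ℝ) else 0 := by
  induction n with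
  | zero => intro b _; simp [N]
  | succ n ih =>
    intro b hb
    rcases n with _ | m
    · simp [N, e]
    · rw [N, ih _ hb.tail]
      simp only [Nat.add_sub_cancel]
      rw [Finset.sum_range_succ', add_comm]
      congr 1
      · refine Finset.sum_congr rfl fun i hi => ?_
        have : m + 1 - 2 - i = m + 1 + 1 - 2 - (i+1) := by omega
        rw [this]
        rfl
      · rw [e, u_eq _ _ hb.tail.tail]
        by_cases h0 : b 0 = 1 <;> by_cases h1 : b 1 = 1 <;> simp [h0, h1, add_assoc]

lemma btilde_iff (a k : ℕ) (b : ℕ → ℤ) (hb : V (a+1+k) b) (hS : 0 ≤ cdgS (a+1+k) b)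
    (h1 : b a = 1) :
    btilde (a+1+k) b a = 1 ↔ 0 ≤ cdgS k (fun i => b (i+(a+1))) := by
  have hB := S_bound k _ (hb.shift (a+1) k le_rfl)
  have hs := S_split (a+1) k b
  have hs1 : cdgS (a+1) b = 2 * cdgS a b + 1 := by
    rw [S_split a 1 b]; simp [cdgS, h1]
  rw [hs1] at hs
  set T := cdgS k (fun i => b (i+(a+1))) with hT
  set S := cdgS (a+1+k) b with hSS
  have hbt : ((btilde (a+1+k) b a : ℕ) : ℤ) = S / 2 ^ k % 2 := by
    unfold btilde
    have : a + 1 + k - 1 - a = k := by omega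
    rw [this]
    push_cast
    rw [← hSS, Int.toNat_of_nonneg hS]
  have hp : (0:ℤ) < 2 ^ k := by positivity
  by_cases hT0 : 0 ≤ T
  · have : S / 2 ^ k = 2 * cdgS a b + 1 := by
      rw [hs, Int.mul_add_ediv_left _ _ hp.ne', Int.ediv_eq_zero_of_lt hT0 hB.2, add_zero]
    rw [this] at hbt
    simp only [hT0, iff_true]
    omega
  · have : S / 2 ^ k = 2 * cdgS a b := by
      have h2 : S = 2 ^ k * (2 * cdgS a b) + (T + 2 ^ k) := by rw [hs]; ring
      rw [h2, Int.mul_add_ediv_left _ _ hp.ne',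
        Int.ediv_eq_zero_of_lt (by linarith) (by linarith), add_zero]
    rw [this] at hbt
    simp only [hT0, iff_false]
    omega

lemma pred_iff (i k : ℕ) (b : ℕ → ℤ) (hb : V (i+2+k) b) (hS : 0 ≤ cdgS (i+2+k) b) :
    (btilde (i+2+k) b i = 1 ∧ btilde (i+2+k) b (i+1) = 1 ∧ b i = 1 ∧ b (i+1) = 1) ↔
    (b i = 1 ∧ b (i+1) = 1 ∧ 0 ≤ cdgS k (fun j => b (j+(i+2)))) := by
  by_cases h0 : b i = 1
  swap
  · simp [h0]
  by_cases h1 : b (i+1) = 1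
  swap
  · simp [h1]
  have e1 : i + 2 + k = i + 1 + (k+1) := by ring
  have A := btilde_iff (i+1) k b hb hS h1
  have B := btilde_iff i (k+1) b (e1 ▸ hb) (e1 ▸ hS) h0
  rw [← e1] at B
  have hBd := S_bound k _ (hb.shift (i+2) k le_rfl)
  have hs : cdgS (k+1) (fun j => b (j+(i+1))) = 2 ^ k + cdgS k (fun j => b (j+(i+2))) := by
    rw [S_succ]
    simp only [zero_add, h1, mul_one]
    congr 2
    funext j
    congr 1
    ring
  rw [hs] at B
  simp only [h0, h1, and_true, true_and]
  have A' : btilde (i+2+k) b (i+1) = 1 ↔ 0 ≤ cdgS k (fun j => b (j+(i+2))) := A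
  rw [A', B]
  constructor
  · exact fun h => h.2
  · exact fun h => ⟨by linarith, h⟩

lemma card_eq (n : ℕ) (b : ℕ → ℤ) (hb : V n b) (hF : b ∈ firstOne n) :
    (((Finset.Ico 1 n).filter (fun a =>
            btilde n b (a - 1) = 1 ∧ btilde n b a = 1 ∧ b (a - 1) = 1 ∧ b a = 1)).card : ℝ)
      = N n b := by
  have hS := S_nonneg n b hb hF
  rw [N_eq n b hb, Finset.card_filter, Nat.cast_sum, Finset.sum_Ico_eq_sum_range]
  refine Finset.sum_congr rfl fun i hi => ?_
  have hi' := Finset.mem_range.1 hi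
  obtain ⟨k, rfl⟩ : ∃ k, n = i + 2 + k := ⟨n - 2 - i, by omega⟩
  have hk : i + 2 + k - 2 - i = k := by omega
  have := pred_iff i k b hb hS
  rw [hk, Nat.add_sub_cancel_left, add_comm 1 i]
  push_cast
  simp only [this]

/-- extension of a finite word -/
def ext {n : ℕ} (c : Fin n → Fin 3) (i : ℕ) : ℤ := if h : i < n then ((c ⟨i, h⟩ : ℕ) : ℤ) - 1 else 0

lemma ext_tail {n : ℕ} (x : Fin 3) (c : Fin n → Fin 3) :
    (fun i => ext (Fin.cons x c : Fin (n+1) → Fin 3) (i+1)) = ext c := by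
  funext i
  unfold ext
  by_cases h : i < n
  · rw [dif_pos h, dif_pos (by omega)]
    have : (⟨i+1, by omega⟩ : Fin (n+1)) = Fin.succ ⟨i, h⟩ := rfl
    rw [this, Fin.cons_succ]
  · rw [dif_neg h, dif_neg (by omega)]

lemma ext_zero {n : ℕ} (x : Fin 3) (c : Fin n → Fin 3) :
    ext (Fin.cons x c : Fin (n+1) → Fin 3) 0 = ((x : ℕ) : ℤ) - 1 := by
  unfold ext
  rw [dif_pos (by omega)]
  rfl

lemma step {n : ℕ} (c : Fin n → Fin 3) :
    ∑ x : Fin 3, (Phi (n+1) (ext (Fin.cons x c : Fin (n+1) → Fin 3)))^2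
      ≤ 3 * (Phi n (ext c))^2 + 12 := by
  simp only [Phi, N, u, e_succ, ext_tail, ext_zero, Fin.sum_univ_three]
  have hu := u_mem n (ext c)
  have he := e_mem n (ext c)
  generalize u n (ext c) = u at *
  generalize e n (ext c) = e at *
  generalize N n (ext c) = N at *
  norm_num
  set P := N + u / 6 + e / 3 - n / 18 with hP
  have hN : N = P - u/6 - e/3 + n/18 := by rw [hP]; ring
  rw [hN]
  obtain ⟨hu0, hu1⟩ := hu
  obtain ⟨he0, he1⟩ := he
  have uu : u * u ≤ 1 := by nlinarith
  have ee : e * e ≤ 1 := by nlinarith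
  have ue : u * e ≤ 1 := by nlinarith
  have ue0 : 0 ≤ u * e := by positivity
  nlinarith

lemma second_moment (n : ℕ) :
    ∑ c : Fin n → Fin 3, (Phi n (ext c))^2 ≤ (1 + 4 * n) * 3 ^ n := by
  induction n with
  | zero => simp [Phi, N, u, e]; norm_num
  | succ n ih =>
    rw [← (Fin.consEquiv (fun _ : Fin (n+1) => Fin 3)).sum_comp, Fintype.sum_prod_type,
      Finset.sum_comm]
    calc _ ≤ ∑ c : Fin n → Fin 3, (3 * (Phi n (ext c))^2 + 12) :=
          Finset.sum_le_sum fun c _ => step c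
      _ = 3 * ∑ c : Fin n → Fin 3, (Phi n (ext c))^2 + 12 * 3 ^ n := by
          rw [Finset.sum_add_distrib, Finset.mul_sum]; simp; ring
      _ ≤ _ := by push_cast; rw [pow_succ]; nlinarith

lemma not_V_null {μ : Measure (ℕ → ℤ)} (hμ : IsCDGProductMeasure μ) (n : ℕ) :
    μ {ω | ¬ V n ω} = 0 := by
  have hsub : {ω | ¬ V n ω} ⊆ ⋃ c : {c : Fin n → ℤ // ∃ i, ¬ (c i = -1 ∨ c i = 0 ∨ c i = 1)},
      {ω : ℕ → ℤ | ∀ i < n, ω i = (fun j => if h : j < n then c.1 ⟨j, h⟩ else 0) i} := by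
    intro ω hω
    simp only [Set.mem_setOf_eq, V, not_forall] at hω
    obtain ⟨i, hi, h⟩ := hω
    rw [Set.mem_iUnion]
    refine ⟨⟨fun j => ω j, ⟨i, hi⟩, h⟩, ?_⟩
    intro j hj
    simp [hj]
  refine measure_mono_null hsub (measure_iUnion_null fun c => ?_)
  rw [hμ]
  obtain ⟨i, hi⟩ := c.2
  refine Finset.prod_eq_zero (Finset.mem_range.2 i.2) ?_
  simp only [i.2, dif_pos, Fin.eta]
  rw [if_neg hi]

lemma cyl {μ : Measure (ℕ → ℤ)} (hμ : IsCDGProductMeasure μ) (n : ℕ) (c : Fin n → Fin 3) :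
    μ {ω | ∀ i < n, ω i = ext c i} = ENNReal.ofReal ((1/3) ^ n) := by
  rw [hμ, Finset.prod_congr rfl (g := fun _ => ENNReal.ofReal (1/3))]
  · rw [Finset.prod_const, Finset.card_range, ENNReal.ofReal_pow (by norm_num)]
  · intro i hi
    have hi' := Finset.mem_range.1 hi
    rw [if_pos]
    · rw [ENNReal.ofReal_div_of_pos (by norm_num)]; simp
    · unfold ext
      rw [dif_pos hi']
      have := (c ⟨i, hi'⟩).2
      omega

lemma tail_bound {μ : Measure (ℕ → ℤ)} (hμ : IsCDGProductMeasure μ) (n : ℕ) (t : ℝ) (ht : 0 < t) :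
    μ {ω | V n ω ∧ t ≤ (Phi n ω)^2} ≤ ENNReal.ofReal ((1 + 4 * n) / t) := by
  classical
  set B := Finset.univ.filter (fun c : Fin n → Fin 3 => t ≤ (Phi n (ext c))^2) with hB
  have hsub : {ω | V n ω ∧ t ≤ (Phi n ω)^2} ⊆ ⋃ c ∈ B, {ω | ∀ i < n, ω i = ext c i} := by
    rintro ω ⟨hV, hω⟩
    have hc : ∀ i : Fin n, ∃ x : Fin 3, ω i = ((x : ℕ) : ℤ) - 1 := by
      intro i
      rcases hV i i.2 with h | h | h
      · exact ⟨0, by rw [h]; rfl⟩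
      · exact ⟨1, by rw [h]; rfl⟩
      · exact ⟨2, by rw [h]; rfl⟩
    choose c hc using hc
    have hag : ∀ i < n, ω i = ext c i := by
      intro i hi
      unfold ext
      rw [dif_pos hi, ← hc ⟨i, hi⟩]
    simp only [Set.mem_iUnion]
    refine ⟨c, ?_, hag⟩
    rw [hB, Finset.mem_filter, ← Phi_congr n ω _ hag]
    exact ⟨Finset.mem_univ _, hω⟩
  have hcard : (B.card : ℝ) * t ≤ (1 + 4 * n) * 3 ^ n := by
    refine le_trans ?_ (second_moment n)
    calc (B.card : ℝ) * t = ∑ c ∈ B, t := by simp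
      _ ≤ ∑ c ∈ B, (Phi n (ext c))^2 :=
        Finset.sum_le_sum fun c hc => (Finset.mem_filter.1 hc).2
      _ ≤ _ := Finset.sum_le_sum_of_subset_of_nonneg (Finset.subset_univ _)
        fun _ _ _ => sq_nonneg _
  calc _ ≤ _ := measure_mono hsub
    _ ≤ ∑ c ∈ B, μ {ω | ∀ i < n, ω i = ext c i} := measure_biUnion_finset_le _ _
    _ = ENNReal.ofReal (B.card * (1/3)^n) := by
      rw [Finset.sum_congr rfl fun c _ => cyl hμ n c, Finset.sum_const, nsmul_eq_mul,
        ENNReal.ofReal_mul (by positivity), ENNReal.ofReal_natCast]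
    _ ≤ _ := by
      apply ENNReal.ofReal_le_ofReal
      rw [le_div_iff₀ ht]
      have h3 : (3:ℝ)^n * (1/3)^n = 1 := by rw [← mul_pow]; norm_num
      have hp : (0:ℝ) < (1/3)^n := by positivity
      calc (B.card : ℝ) * (1/3)^n * t = (B.card * t) * (1/3)^n := by ring
        _ ≤ ((1 + 4 * n) * 3 ^ n) * (1/3)^n := by gcongr
        _ = _ := by rw [mul_assoc, h3, mul_one]

lemma firstOne_meas (n : ℕ) : MeasurableSet (firstOne n) := by
  have : firstOne n = ⋃ j ∈ Finset.range n,
      ((fun b : ℕ → ℤ => b j) ⁻¹' {1} ∩ ⋂ k ∈ Finset.range j, (fun b : ℕ → ℤ => b k) ⁻¹' {0}) := by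
    ext b
    simp only [firstOne, Set.mem_iUnion, Finset.mem_range, Set.mem_inter_iff, Set.mem_iInter,
      Set.mem_preimage, Set.mem_singleton_iff, exists_prop]
    rfl
  rw [this]
  refine Finset.measurableSet_biUnion _ fun j _ => MeasurableSet.inter ?_ ?_
  · exact measurable_pi_apply j (measurableSet_singleton _)
  · exact Finset.measurableSet_biInter _ fun k _ =>
      measurable_pi_apply k (measurableSet_singleton _)

lemma firstOne_ge {μ : Measure (ℕ → ℤ)} (hμ : IsCDGProductMeasure μ) (n : ℕ) (hn : 1 ≤ n) :
    1 / 3 ≤ μ (firstOne n) := by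
  have h := hμ 1 (fun _ => 1)
  simp only [Finset.prod_range_one, or_true, if_true] at h
  rw [← h]
  refine measure_mono fun ω hω => ⟨0, by omega, hω 0 (by omega), fun k hk => by omega⟩

end CDG

/-- with `n₁(ω)` the number of `a ∈ {1,…,n−1}` with
`b̃_{a-1} = 1`, `b̃_a = 1`, `b_{a-1} = 1`, `b_a = 1`, for every `ε > 0` the conditional
probability `μ((1/18 − ε)n < n₁ < (1/18 + ε)n ∣ F_n) → 1` as `n → ∞`. -/
theorem stmt_5 (μ : Measure (ℕ → ℤ)) (hμ : IsCDGProductMeasure μ) (ε : ℝ) (hε : 0 < ε) :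
    Tendsto (fun n : ℕ =>
      μ[|firstOne n] {ω : ℕ → ℤ |
        (1 / 18 - ε) * n <
          (((Finset.Ico 1 n).filter (fun a =>
            btilde n ω (a - 1) = 1 ∧ btilde n ω a = 1 ∧ ω (a - 1) = 1 ∧ ω a = 1)).card : ℝ) ∧
        (((Finset.Ico 1 n).filter (fun a =>
            btilde n ω (a - 1) = 1 ∧ btilde n ω a = 1 ∧ ω (a - 1) = 1 ∧ ω a = 1)).card : ℝ) <
          (1 / 18 + ε) * n})
      atTop (nhds 1) := by
  have huniv : μ Set.univ = 1 := by simpa using hμ 0 (fun _ => 0)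
  haveI : IsProbabilityMeasure μ := ⟨huniv⟩
  have hlow : Tendsto (fun n : ℕ => 1 - ENNReal.ofReal (60 / ε ^ 2 / n)) atTop (nhds 1) := by
    have h1 : Tendsto (fun n : ℕ => ENNReal.ofReal (60 / ε ^ 2 / n)) atTop (nhds 0) := by
      have := ENNReal.tendsto_ofReal (tendsto_const_div_atTop_nhds_zero_nat (60 / ε ^ 2))
      simpa using this
    have := ENNReal.Tendsto.sub (tendsto_const_nhds (x := (1 : ENNReal))) h1 (Or.inl (by simp))
    simpa using this
  refine tendsto_of_tendsto_of_tendsto_of_le_of_le' hlow tendsto_const_nhds ?_ ?_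
  swap
  · filter_upwards [eventually_ge_atTop 1] with n hn
    have h3 := CDG.firstOne_ge hμ n hn
    have hne : μ (firstOne n) ≠ 0 := by
      intro h; rw [h] at h3; simp at h3
    haveI := cond_isProbabilityMeasure hne
    exact prob_le_one
  filter_upwards [eventually_ge_atTop 1, eventually_ge_atTop ⌈1 / ε⌉₊] with n hn hn2
  have h3 := CDG.firstOne_ge hμ n hn
  have hne : μ (firstOne n) ≠ 0 := by
    intro h; rw [h] at h3; simp at h3
  haveI := cond_isProbabilityMeasure hne
  set G := {ω : ℕ → ℤ |
        (1 / 18 - ε) * n <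
          (((Finset.Ico 1 n).filter (fun a =>
            btilde n ω (a - 1) = 1 ∧ btilde n ω a = 1 ∧ ω (a - 1) = 1 ∧ ω a = 1)).card : ℝ) ∧
        (((Finset.Ico 1 n).filter (fun a =>
            btilde n ω (a - 1) = 1 ∧ btilde n ω a = 1 ∧ ω (a - 1) = 1 ∧ ω a = 1)).card : ℝ) <
          (1 / 18 + ε) * n} with hG
  have hn' : (1:ℝ) ≤ n := by exact_mod_cast hn
  have hεn : 1 ≤ ε * n := by
    have : 1 / ε ≤ n := Nat.ceil_le.1 hn2
    rwa [div_le_iff₀' hε] at this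
  have hsub : firstOne n ∩ Gᶜ ⊆
      {ω | ¬ CDG.V n ω} ∪ {ω | CDG.V n ω ∧ (ε * n / 2) ^ 2 ≤ (CDG.Phi n ω) ^ 2} := by
    rintro ω ⟨hF, hω⟩
    by_cases hV : CDG.V n ω
    · right
      refine ⟨hV, ?_⟩
      simp only [hG, Set.mem_compl_iff, Set.mem_setOf_eq] at hω
      rw [CDG.card_eq n ω hV hF] at hω
      have hu := CDG.u_mem n ω
      have he := CDG.e_mem n ω
      rw [sq_le_sq, abs_of_nonneg (by positivity), le_abs]
      unfold CDG.Phi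
      rw [not_and_or, not_lt, not_lt] at hω
      rcases hω with h | h
      · right; nlinarith
      · left; nlinarith
    · left; exact hV
  have hbad : μ (firstOne n ∩ Gᶜ) ≤ ENNReal.ofReal (20 / ε ^ 2 / n) := by
    refine (measure_mono hsub).trans ((measure_union_le _ _).trans ?_)
    rw [CDG.not_V_null hμ, zero_add]
    refine (CDG.tail_bound hμ n _ (by positivity)).trans (ENNReal.ofReal_le_ofReal ?_)
    have : 20 / ε ^ 2 / n = (5 * n) / (ε * n / 2) ^ 2 := by
      have : (n:ℝ) ≠ 0 := by positivity
      field_simp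
      norm_num
    rw [this]
    gcongr
    linarith
  have hcond : μ[|firstOne n] Gᶜ ≤ ENNReal.ofReal (60 / ε ^ 2 / n) := by
    rw [cond_apply (CDG.firstOne_meas n)]
    have hinv : (μ (firstOne n))⁻¹ ≤ 3 := by
      rw [ENNReal.inv_le_iff_inv_le]
      simpa using h3
    calc _ ≤ 3 * ENNReal.ofReal (20 / ε ^ 2 / n) := mul_le_mul' hinv hbad
      _ = ENNReal.ofReal (60 / ε ^ 2 / n) := by
        have : (3 : ENNReal) = ENNReal.ofReal 3 := by simp
        rw [this, ← ENNReal.ofReal_mul (by norm_num)]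
        congr 1
        ring
  rw [tsub_le_iff_right]
  calc (1 : ENNReal) = μ[|firstOne n] (G ∪ Gᶜ) := by rw [Set.union_compl_self, measure_univ]
    _ ≤ μ[|firstOne n] G + μ[|firstOne n] Gᶜ := measure_union_le _ _
    _ ≤ _ := by gcongr
end

section
/- For ω ∈ F_n let n₃(ω) be the number of a ∈ {1, …, n−1} such that b̃_{a-1} = 1, b̃_a = 1, b_{a-1} ≠ 1, and b_a = 1. Then for every ε > 0, the conditional probability μ( (1/18 − ε)·n < n₃ < (1/18 + ε)·n ∣ F_n ) tends to 1 as n → ∞. -/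
open MeasureTheory ProbabilityTheory Filter

/-- Sum of `f` over all lists of length `n` with entries in `{-1,0,1}`. -/
noncomputable def lsum : ℕ → (List ℤ → ℝ) → ℝ
  | 0, f => f []
  | n + 1, f => lsum n (fun l => f ((-1) :: l)) + lsum n (fun l => f (0 :: l))
      + lsum n (fun l => f (1 :: l))

/-- the borrow -/
def carry : List ℤ → ℤ
  | [] => 0
  | d :: l => if d = -1 then 1 else if d = 0 then carry l else 0

/-- first digit is `1` and no borrow from the tail -/
def flag : List ℤ → ℤ
  | [] => 0
  | d :: l => if d = 1 then 1 - carry l else 0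

/-- number of patterns -/
def cnt : List ℤ → ℤ
  | [] => 0
  | d :: l => cnt l + if d = -1 then flag l else 0

/-- the martingale -/
noncomputable def mart (l : List ℤ) : ℝ :=
  cnt l - (l.length : ℝ) / 18 - carry l / 6 + flag l / 3

lemma lsum_mono (n : ℕ) : ∀ (f g : List ℤ → ℝ), (∀ l, l.length = n → f l ≤ g l) →
    lsum n f ≤ lsum n g := by
  induction n with
  | zero => intro f g h; exact h [] rfl
  | succ n ih =>
    intro f g h
    simp only [lsum]
    have h1 := ih _ _ (fun l hl => h ((-1) :: l) (by simp [hl]))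
    have h2 := ih _ _ (fun l hl => h (0 :: l) (by simp [hl]))
    have h3 := ih _ _ (fun l hl => h (1 :: l) (by simp [hl]))
    linarith

lemma lsum_add (n : ℕ) : ∀ (f g : List ℤ → ℝ), lsum n (fun l => f l + g l) = lsum n f + lsum n g := by
  induction n with
  | zero => intro f g; rfl
  | succ n ih =>
    intro f g
    simp only [lsum, ih]
    ring

lemma lsum_mul (n : ℕ) (r : ℝ) : ∀ (f : List ℤ → ℝ), lsum n (fun l => r * f l) = r * lsum n f := by
  induction n with
  | zero => intro f; rfl
  | succ n ih =>
    intro f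
    simp only [lsum, ih]
    ring

lemma lsum_const (n : ℕ) (r : ℝ) : lsum n (fun _ => r) = 3 ^ n * r := by
  induction n with
  | zero => simp [lsum]
  | succ n ih =>
    simp only [lsum, ih]
    ring

lemma carry_cases (l : List ℤ) : carry l = 0 ∨ carry l = 1 := by
  induction l with
  | nil => simp [carry]
  | cons d l ih => simp only [carry]; split_ifs <;> simp [ih]

lemma flag_cases (l : List ℤ) : flag l = 0 ∨ flag l = 1 := by
  cases l with
  | nil => simp [flag]
  | cons d l =>
    simp only [flag]
    rcases carry_cases l with h | h <;> split_ifs <;> simp [h]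

lemma mart_step (l : List ℤ) :
    mart ((-1) :: l) ^ 2 + mart (0 :: l) ^ 2 + mart (1 :: l) ^ 2 ≤ 3 * mart l ^ 2 + 12 := by
  have e1 : ∀ d, carry (d :: l) = if d = -1 then 1 else if d = 0 then carry l else 0 := fun _ => rfl
  have e2 : ∀ d, flag (d :: l) = if d = 1 then 1 - carry l else 0 := fun _ => rfl
  have e3 : ∀ d, cnt (d :: l) = cnt l + if d = -1 then flag l else 0 := fun _ => rfl
  simp only [mart, e1, e2, e3, List.length_cons]
  clear e1 e2 e3
  have hc := carry_cases l
  have hf := flag_cases l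
  generalize (cnt l : ℤ) = x
  generalize l.length = k
  generalize carry l = u at *
  generalize flag l = v at *
  rcases hc with rfl | rfl <;> rcases hf with rfl | rfl <;> norm_num <;> ring_nf <;> nlinarith

lemma lsum_mart (n : ℕ) : lsum n (fun l => mart l ^ 2) ≤ 3 ^ n * (4 * n) := by
  induction n with
  | zero => simp [lsum, mart, cnt, carry, flag]
  | succ n ih =>
    simp only [lsum]
    rw [← lsum_add, ← lsum_add]
    calc _ ≤ lsum n (fun l => 3 * mart l ^ 2 + 12) := lsum_mono _ _ _ (fun l _ => mart_step l)
      _ = 3 * lsum n (fun l => mart l ^ 2) + 3 ^ n * 12 := by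
        rw [lsum_add, lsum_mul, lsum_const]
      _ ≤ _ := by push_cast; rw [pow_succ]; linarith

lemma lsum_nonneg (n : ℕ) (f : List ℤ → ℝ) (h : ∀ l, 0 ≤ f l) : 0 ≤ lsum n f := by
  have := lsum_mono n (fun _ => 0) f (fun l _ => h l)
  simpa [lsum_const] using this

open Classical in
lemma meas_bound (μ : Measure (ℕ → ℤ)) (hμ : IsCDGProductMeasure μ) (B : Set (ℕ → ℤ)) (m : ℕ) :
    ∀ (k : ℕ) (c : ℕ → ℤ) (P : List ℤ → Prop),
    (∀ i < k, c i = -1 ∨ c i = 0 ∨ c i = 1) →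
    (∀ ω ∈ B, (∀ i < k + m, ω i = -1 ∨ ω i = 0 ∨ ω i = 1) → (∀ i < k, ω i = c i) →
      P ((List.range' k m).map ω)) →
    μ (B ∩ {ω | ∀ i < k, ω i = c i}) ≤
      ENNReal.ofReal ((1 / 3) ^ (k + m) * lsum m (fun l => if P l then 1 else 0)) := by
  induction m with
  | zero =>
    intro k c P hc hB
    by_cases hP : P []
    · refine (measure_mono Set.inter_subset_right).trans ?_
      rw [hμ k c]
      simp only [lsum, hP, if_true]
      rw [Finset.prod_congr rfl (fun i hi => if_pos (hc i (Finset.mem_range.1 hi)))]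
      simp only [Finset.prod_const, Finset.card_range, add_zero, mul_one]
      rw [ENNReal.ofReal_pow (by norm_num)]
      rw [ENNReal.ofReal_div_of_pos (by norm_num)]
      simp
    · have : B ∩ {ω | ∀ i < k, ω i = c i} = ∅ := by
        ext ω
        simp only [Set.mem_inter_iff, Set.mem_setOf_eq, Set.mem_empty_iff_false, iff_false]
        rintro ⟨h1, h2⟩
        exact hP (by simpa using hB ω h1 (fun i hi => by rw [h2 i hi]; exact hc i hi) h2)
      rw [this]; simp
  | succ m ih =>
    intro k c P hc hB
    have key : ∀ d : ℤ, (d = -1 ∨ d = 0 ∨ d = 1) →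
        μ (B ∩ {ω | ∀ i < k + 1, ω i = Function.update c k d i}) ≤
        ENNReal.ofReal ((1 / 3) ^ (k + 1 + m) * lsum m (fun l => if P (d :: l) then 1 else 0)) := by
      intro d hd
      apply ih (k + 1) (Function.update c k d) (fun l => P (d :: l))
      · intro i hi
        by_cases h : i = k
        · subst h; simpa using hd
        · rw [Function.update_of_ne h]; exact hc i (by omega)
      · intro ω hω h1 h2
        have h3 := hB ω hω (fun i hi => h1 i (by omega)) (fun i hi => by
          rw [h2 i (by omega), Function.update_of_ne (by omega)])
        have h4 := h2 k (by omega)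
        rw [Function.update_self] at h4
        rw [List.range'_succ, List.map_cons, h4] at h3
        exact h3
    have null : ∀ d : ℤ, ¬ (d = -1 ∨ d = 0 ∨ d = 1) →
        μ {ω | ∀ i < k + 1, ω i = Function.update c k d i} = 0 := by
      intro d hd
      rw [hμ, Finset.prod_eq_zero (i := k) (by simp)]
      rw [Function.update_self, if_neg hd]
    have hsub : B ∩ {ω | ∀ i < k, ω i = c i} ⊆
        ((B ∩ {ω | ∀ i < k + 1, ω i = Function.update c k (-1) i} ∪
        B ∩ {ω | ∀ i < k + 1, ω i = Function.update c k 0 i}) ∪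
        B ∩ {ω | ∀ i < k + 1, ω i = Function.update c k 1 i}) ∪
        ⋃ d : {d : ℤ // ¬ (d = -1 ∨ d = 0 ∨ d = 1)},
          {ω | ∀ i < k + 1, ω i = Function.update c k d.1 i} := by
      rintro ω ⟨h1, h2⟩
      have h3 : ∀ i < k + 1, ω i = Function.update c k (ω k) i := by
        intro i hi
        by_cases h : i = k
        · subst h; simp
        · rw [Function.update_of_ne h]; exact h2 i (by omega)
      by_cases hv : ω k = -1 ∨ ω k = 0 ∨ ω k = 1
      · left
        rcases hv with h | h | h <;> rw [h] at h3
        · exact Or.inl (Or.inl ⟨h1, h3⟩)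
        · exact Or.inl (Or.inr ⟨h1, h3⟩)
        · exact Or.inr ⟨h1, h3⟩
      · right
        exact Set.mem_iUnion.2 ⟨⟨ω k, hv⟩, h3⟩
    have hnull : μ (⋃ d : {d : ℤ // ¬ (d = -1 ∨ d = 0 ∨ d = 1)},
          {ω | ∀ i < k + 1, ω i = Function.update c k d.1 i}) = 0 :=
      measure_iUnion_null (fun d => null d.1 d.2)
    have nn : ∀ d : ℤ, 0 ≤ (1 / 3 : ℝ) ^ (k + 1 + m) *
        lsum m (fun l => if P (d :: l) then 1 else 0) := fun d =>
      mul_nonneg (by positivity) (lsum_nonneg _ _ (fun l => by split_ifs <;> norm_num))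
    calc _ ≤ _ := measure_mono hsub
      _ ≤ _ := measure_union_le _ _
      _ ≤ _ := by
        rw [hnull, add_zero]
        refine (measure_union_le _ _).trans ((add_le_add (measure_union_le _ _) le_rfl).trans
          ((add_le_add (add_le_add (key (-1) (by simp)) (key 0 (by simp))) (key 1 (by simp))).trans
          (le_of_eq ?_)))
        rw [← ENNReal.ofReal_add (nn _) (nn _), ← ENNReal.ofReal_add (add_nonneg (nn _) (nn _)) (nn _)]
        congr 1
        simp only [lsum]
        rw [show k + (m + 1) = k + 1 + m by omega]
        ring

/-- suffix of length `m` ending at `n` -/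
def suf (n : ℕ) (ω : ℕ → ℤ) (a : ℕ) : List ℤ := (List.range' a (n - a)).map ω

lemma suf_succ (n : ℕ) (ω : ℕ → ℤ) (a : ℕ) (h : a < n) : suf n ω a = ω a :: suf n ω (a + 1) := by
  unfold suf
  rw [show n - a = (n - (a + 1)) + 1 by omega, List.range'_succ, List.map_cons]

lemma suf_self (n : ℕ) (ω : ℕ → ℤ) : suf n ω n = [] := by simp [suf]

/-- tail value, reduced -/
def tv (n : ℕ) (ω : ℕ → ℤ) (a : ℕ) : ℤ :=
  (∑ i ∈ Finset.Ico a n, 2 ^ (n - 1 - i) * ω i) + carry (suf n ω a) * 2 ^ (n - a)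

lemma tv_step (n : ℕ) (ω : ℕ → ℤ) (a : ℕ) (h : a < n) :
    tv n ω a = (ω a - carry (suf n ω (a + 1)) + 2 * carry (suf n ω a)) * 2 ^ (n - 1 - a)
      + tv n ω (a + 1) := by
  unfold tv
  rw [Finset.sum_eq_sum_Ico_succ_bot h]
  rw [show n - a = (n - 1 - a) + 1 by omega, show n - (a + 1) = n - 1 - a by omega, pow_succ]
  ring

lemma dig_cases (n : ℕ) (ω : ℕ → ℤ) (a : ℕ) (h : a < n) (hv : ω a = -1 ∨ ω a = 0 ∨ ω a = 1) :
    (ω a - carry (suf n ω (a + 1)) + 2 * carry (suf n ω a)) = 0 ∨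
    (ω a - carry (suf n ω (a + 1)) + 2 * carry (suf n ω a)) = 1 := by
  rw [suf_succ n ω a h]
  simp only [carry]
  rcases carry_cases (suf n ω (a + 1)) with h1 | h1 <;> rcases hv with h2 | h2 | h2 <;>
    simp [h1, h2]

lemma tv_bound (n : ℕ) (ω : ℕ → ℤ) (hv : ∀ i < n, ω i = -1 ∨ ω i = 0 ∨ ω i = 1) (m : ℕ) :
    ∀ a, a + m = n → 0 ≤ tv n ω a ∧ tv n ω a < 2 ^ m := by
  induction m with
  | zero =>
    intro a ha
    obtain rfl : a = n := by omega
    simp [tv, suf_self, carry]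
  | succ m ih =>
    intro a ha
    have := ih (a + 1) (by omega)
    rw [tv_step n ω a (by omega), show n - 1 - a = m by omega, pow_succ]
    rcases dig_cases n ω a (by omega) (hv a (by omega)) with h | h <;> rw [h] <;>
      constructor <;> linarith

lemma carry_first (n : ℕ) (ω : ℕ → ℤ) (j : ℕ) (hj : j < n) (h1 : ω j = 1)
    (h0 : ∀ k < j, ω k = 0) (i : ℕ) : i ≤ j → carry (suf n ω (j - i)) = 0 := by
  induction i with
  | zero =>
    intro _
    rw [Nat.sub_zero, suf_succ n ω j hj]
    simp [carry, h1]
  | succ i ih =>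
    intro hi
    rw [suf_succ n ω _ (by omega), show j - (i + 1) + 1 = j - i by omega]
    simp [carry, h0 (j - (i + 1)) (by omega), ih (by omega)]

lemma btilde_eq (n : ℕ) (ω : ℕ → ℤ) (hv : ∀ i < n, ω i = -1 ∨ ω i = 0 ∨ ω i = 1)
    (hF : ω ∈ firstOne n) (a : ℕ) (ha : a < n) :
    (btilde n ω a : ℤ) = ω a - carry (suf n ω (a + 1)) + 2 * carry (suf n ω a) := by
  obtain ⟨j, hj, h1, h0⟩ := hF
  have hc := carry_first n ω j hj h1 h0 j le_rfl
  rw [Nat.sub_self] at hc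
  have hS : cdgS n ω = tv n ω 0 := by
    unfold tv cdgS; rw [hc, Finset.range_eq_Ico]; simp
  have hS0 : 0 ≤ cdgS n ω := by rw [hS]; exact (tv_bound n ω hv n 0 (by omega)).1
  obtain ⟨b0, b1⟩ := tv_bound n ω hv (n - 1 - a) (a + 1) (by omega)
  set D := ω a - carry (suf n ω (a + 1)) + 2 * carry (suf n ω a) with hD
  have hDc : D = 0 ∨ D = 1 := dig_cases n ω a ha (hv a ha)
  have hdec : ∃ A : ℤ, cdgS n ω = tv n ω (a + 1) + (2 * A + D) * 2 ^ (n - 1 - a) := by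
    have e1 : cdgS n ω = ∑ i ∈ Finset.Ico 0 a, 2 ^ (n - 1 - i) * ω i +
        ∑ i ∈ Finset.Ico a n, 2 ^ (n - 1 - i) * ω i := by
      unfold cdgS
      rw [Finset.range_eq_Ico, Finset.sum_Ico_consecutive _ (Nat.zero_le _) ha.le]
    have e2 := tv_step n ω a ha
    rw [← hD] at e2
    have e3 : tv n ω a = (∑ i ∈ Finset.Ico a n, 2 ^ (n - 1 - i) * ω i) +
      carry (suf n ω a) * 2 ^ (n - a) := rfl
    have e4 : ∑ i ∈ Finset.Ico 0 a, 2 ^ (n - 1 - i) * ω i =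
        (∑ i ∈ Finset.Ico 0 a, 2 ^ (a - 1 - i) * ω i) * 2 ^ (n - a) := by
      rw [Finset.sum_mul]
      refine Finset.sum_congr rfl (fun i hi => ?_)
      have := Finset.mem_Ico.1 hi
      rw [show n - 1 - i = (a - 1 - i) + (n - a) by omega, pow_add]
      ring
    refine ⟨(∑ i ∈ Finset.Ico 0 a, 2 ^ (a - 1 - i) * ω i) - carry (suf n ω a), ?_⟩
    rw [e4] at e1
    rw [show n - a = (n - 1 - a) + 1 by omega, pow_succ] at e1 e3
    rw [e1]
    linear_combination e2 - e3
  obtain ⟨A, hA⟩ := hdec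
  unfold btilde
  push_cast
  rw [Int.toNat_of_nonneg hS0, hA, Int.add_mul_ediv_right _ _ (by positivity),
    Int.ediv_eq_zero_of_lt b0 b1]
  omega

lemma cnt_eq (n : ℕ) (ω : ℕ → ℤ) (hv : ∀ i < n, ω i = -1 ∨ ω i = 0 ∨ ω i = 1)
    (hF : ω ∈ firstOne n) (m : ℕ) : ∀ a, a + m = n →
    cnt (suf n ω a) = (((Finset.Ico (a + 1) n).filter (fun a =>
            btilde n ω (a - 1) = 1 ∧ btilde n ω a = 1 ∧ ω (a - 1) ≠ 1 ∧ ω a = 1)).card : ℤ) := by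
  induction m with
  | zero =>
    intro a ha
    obtain rfl : a = n := by omega
    simp [suf_self, cnt]
  | succ m ih =>
    intro a ha
    rw [suf_succ n ω a (by omega)]
    simp only [cnt]
    rw [ih (a + 1) (by omega)]
    by_cases hm : a + 1 < n
    · rw [← Finset.insert_Ico_add_one_left_eq_Ico hm, Finset.filter_insert]
      have e1 := btilde_eq n ω hv hF a (by omega)
      have e2 := btilde_eq n ω hv hF (a + 1) (by omega)
      have v1 := hv a (by omega)
      have v2 := hv (a + 1) (by omega)
      rw [suf_succ n ω a (by omega), suf_succ n ω (a + 1) hm] at e1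
      rw [suf_succ n ω (a + 1) hm] at e2 ⊢
      simp only [carry, flag] at e1 e2 ⊢
      have c1 := carry_cases (suf n ω (a + 1 + 1))
      simp only [Nat.add_sub_cancel]
      have hiff : (btilde n ω a = 1 ∧ btilde n ω (a + 1) = 1 ∧ ω a ≠ 1 ∧ ω (a + 1) = 1) ↔
          (ω a = -1 ∧ ω (a + 1) = 1 ∧ carry (suf n ω (a + 1 + 1)) = 0) := by
        rcases c1 with c1 | c1 <;> rcases v1 with v1 | v1 | v1 <;> rcases v2 with v2 | v2 | v2 <;>
          simp only [c1, v1, v2] at e1 e2 ⊢ <;> norm_num at e1 e2 ⊢ <;> omega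
      split_ifs with g1 g2 g3 g3 g4
      all_goals first
        | (rw [Finset.card_insert_of_notMem (by simp)]; push_cast; have := hiff.1 ‹_›; omega)
        | (have := hiff.1 ‹_›; omega)
        | (rcases c1 with c1 | c1
           · exact absurd (hiff.2 ⟨‹_›, ‹_›, c1⟩) ‹_›
           · rw [c1]; simp)
        | simp
    · obtain rfl : n = a + 1 := by omega
      simp [suf_self, flag]

lemma measurable_firstOne (n : ℕ) : MeasurableSet (firstOne n) := by
  have : firstOne n = ⋃ j : ℕ, ⋃ _ : j < n, ({b : ℕ → ℤ | b j = 1} ∩ ⋂ k : ℕ, ⋂ _ : k < j,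
      {b : ℕ → ℤ | b k = 0}) := by
    ext b; simp [firstOne]
    exact exists_congr fun j => by tauto
  rw [this]
  have hm : ∀ (k : ℕ) (z : ℤ), MeasurableSet {b : ℕ → ℤ | b k = z} := fun k z =>
    measurableSet_eq_fun (measurable_pi_apply k) measurable_const
  refine MeasurableSet.iUnion fun j => MeasurableSet.iUnion fun _ => (hm _ _).inter ?_
  exact MeasurableSet.iInter fun k => MeasurableSet.iInter fun _ => hm _ _

open Classical in
lemma bad_bound (μ : Measure (ℕ → ℤ)) (hμ : IsCDGProductMeasure μ) (ε : ℝ) (hε : 0 < ε) (n : ℕ)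
    (hn : 1 ≤ ε * n) (B : Set (ℕ → ℤ))
    (hB : ∀ ω ∈ B, (∀ i < n, ω i = -1 ∨ ω i = 0 ∨ ω i = 1) →
      ε * n ≤ |(cnt (suf n ω 0) : ℝ) - n / 18|) :
    μ B ≤ ENNReal.ofReal (16 / (ε ^ 2 * n)) := by
  have hn0 : (0 : ℝ) < n := by
    rcases Nat.eq_zero_or_pos n with h | h
    · subst h; norm_num at hn
    · exact_mod_cast h
  have h := meas_bound μ hμ B n 0 (fun _ => 0)
    (fun l => ε * n ≤ |(cnt l : ℝ) - n / 18|) (by simp)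
    (fun ω hω hv _ => by
      have := hB ω hω (fun i hi => hv i (by omega))
      simpa [suf] using this)
  simp only [Nat.not_lt_zero, false_imp_iff, implies_true, Set.setOf_true, Set.inter_univ,
    zero_add] at h
  refine h.trans (ENNReal.ofReal_le_ofReal ?_)
  have h1 : lsum n (fun l => if ε * n ≤ |(cnt l : ℝ) - n / 18| then (1 : ℝ) else 0) ≤
      lsum n (fun l => (4 / (ε * n) ^ 2) * mart l ^ 2) := by
    apply lsum_mono
    intro l hl
    split_ifs with hc
    · have hm : ε * n / 2 ≤ |mart l| := by
        have e : (cnt l : ℝ) - n / 18 = mart l + (carry l / 6 - flag l / 3) := by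
          simp only [mart, hl]; ring
        have e2 : |((carry l : ℝ) / 6 - flag l / 3)| ≤ 1 / 2 := by
          rcases carry_cases l with h | h <;> rcases flag_cases l with h' | h' <;>
            rw [h, h'] <;> norm_num [abs_le]
        rw [e] at hc
        have := abs_add_le (mart l) ((carry l : ℝ) / 6 - flag l / 3)
        linarith
      have hsq : (ε * n / 2) ^ 2 ≤ mart l ^ 2 := by
        rw [← sq_abs (mart l)]
        exact pow_le_pow_left₀ (by positivity) hm 2
      rw [div_mul_eq_mul_div, le_div_iff₀ (by positivity)]
      nlinarith
    · positivity
  rw [lsum_mul] at h1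
  have h2 := lsum_mart n
  calc _ ≤ (1 / 3 : ℝ) ^ n * ((4 / (ε * n) ^ 2) * (3 ^ n * (4 * n))) := by
        refine mul_le_mul_of_nonneg_left (h1.trans ?_) (by positivity)
        exact mul_le_mul_of_nonneg_left h2 (by positivity)
    _ = 16 / (ε ^ 2 * n) := by
      rw [one_div, inv_pow]
      field_simp
      norm_num

/-- with `n₃(ω)` the number of `a ∈ {1,…,n−1}` with `b̃_{a-1} = 1`, `b̃_a = 1`, `b_{a-1} ≠ 1`, `b_a = 1`, for every `ε > 0` the conditional probability `μ((1/18 − ε)n < n₃ < (1/18 + ε)n ∣ F_n) → 1` as `n → ∞`. -/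
theorem stmt_7 (μ : Measure (ℕ → ℤ)) (hμ : IsCDGProductMeasure μ) (ε : ℝ) (hε : 0 < ε) :
    Tendsto (fun n : ℕ =>
      μ[|firstOne n] {ω : ℕ → ℤ |
        (1 / 18 - ε) * n <
          (((Finset.Ico 1 n).filter (fun a =>
            btilde n ω (a - 1) = 1 ∧ btilde n ω a = 1 ∧ ω (a - 1) ≠ 1 ∧ ω a = 1)).card : ℝ) ∧
        (((Finset.Ico 1 n).filter (fun a =>
            btilde n ω (a - 1) = 1 ∧ btilde n ω a = 1 ∧ ω (a - 1) ≠ 1 ∧ ω a = 1)).card : ℝ) <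
          (1 / 18 + ε) * n})
      atTop (nhds 1) := by
  have huniv : μ Set.univ = 1 := by
    have := hμ 0 (fun _ => 0)
    simpa using this
  haveI : IsProbabilityMeasure μ := ⟨huniv⟩
  have hF : ∀ n : ℕ, 1 ≤ n → (1 / 3 : ENNReal) ≤ μ (firstOne n) := by
    intro n hn
    have h1 := hμ 1 (fun _ => 1)
    simp only [Finset.range_one, Finset.prod_singleton, or_true, if_true] at h1
    rw [← h1]
    refine measure_mono fun ω hω => ⟨0, by omega, hω 0 (by omega), by simp⟩
  have hlim : Tendsto (fun n : ℕ => 1 - 3 * ENNReal.ofReal (16 / (ε ^ 2 * n))) atTop (nhds 1) := by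
    have t1 : Tendsto (fun n : ℕ => 16 / (ε ^ 2 * (n : ℝ))) atTop (nhds 0) :=
      Tendsto.const_div_atTop
        (Tendsto.const_mul_atTop (by positivity) tendsto_natCast_atTop_atTop) _
    have t2 := ENNReal.tendsto_ofReal t1
    have t3 := ENNReal.Tendsto.const_mul (a := 3) t2 (Or.inr (by simp))
    have t4 := ENNReal.Tendsto.sub (tendsto_const_nhds (x := (1 : ENNReal)) (f := atTop (α := ℕ))) t3
      (Or.inl (by simp))
    simpa using t4
  have hbig : ∀ᶠ n : ℕ in atTop, 1 ≤ ε * n := by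
    have : Tendsto (fun n : ℕ => ε * (n : ℝ)) atTop atTop :=
      Tendsto.const_mul_atTop hε tendsto_natCast_atTop_atTop
    exact this.eventually_ge_atTop 1
  refine tendsto_of_tendsto_of_tendsto_of_le_of_le' hlim tendsto_const_nhds ?_ ?_
  · filter_upwards [hbig, eventually_ge_atTop 1] with n hn hn1
    set G := {ω : ℕ → ℤ |
        (1 / 18 - ε) * n <
          (((Finset.Ico 1 n).filter (fun a =>
            btilde n ω (a - 1) = 1 ∧ btilde n ω a = 1 ∧ ω (a - 1) ≠ 1 ∧ ω a = 1)).card : ℝ) ∧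
        (((Finset.Ico 1 n).filter (fun a =>
            btilde n ω (a - 1) = 1 ∧ btilde n ω a = 1 ∧ ω (a - 1) ≠ 1 ∧ ω a = 1)).card : ℝ) <
          (1 / 18 + ε) * n} with hG
    have hFn := hF n hn1
    have hne : μ (firstOne n) ≠ 0 := fun h => by
      rw [h] at hFn; simp at hFn
    haveI := cond_isProbabilityMeasure hne
    have hbad : μ[|firstOne n] Gᶜ ≤ 3 * ENNReal.ofReal (16 / (ε ^ 2 * n)) := by
      rw [cond_apply (measurable_firstOne n)]
      refine mul_le_mul' ?_ ?_
      · rw [ENNReal.inv_le_iff_inv_le]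
        simpa using hFn
      · apply bad_bound μ hμ ε hε n hn
        rintro ω ⟨hω, hωG⟩ hv
        have hc := cnt_eq n ω hv hω n 0 (by omega)
        by_contra hlt
        push Not at hlt
        apply hωG
        rw [abs_lt, hc] at hlt
        push_cast at hlt
        constructor <;> linarith [hlt.1, hlt.2]
    have hone : (1 : ENNReal) ≤ μ[|firstOne n] G + μ[|firstOne n] Gᶜ := by
      rw [← measure_univ (μ := μ[|firstOne n]), ← Set.union_compl_self G]
      exact measure_union_le _ _
    refine tsub_le_iff_right.2 (hone.trans ?_)
    gcongr
  · filter_upwards [eventually_ge_atTop 1] with n hn1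
    have hFn := hF n hn1
    have hne : μ (firstOne n) ≠ 0 := fun h => by
      rw [h] at hFn; simp at hFn
    haveI := cond_isProbabilityMeasure hne
    exact prob_le_one
end
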